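/- For all integers n ≥ 1 and j ≥ 0, the number of decorated Motzkin walks of length n from 0 to 1 that are positive except at the origin, whose last step of value 0 or +1 is a +1-step, and that contain exactly j steps of value 0, is equal to the number of nonnegative basketball walks of length n-1 from 0 to 0 that contain exactly j staggered ±2-steps. -/

import Mathlib

/-- Height of a walk (given by its list of steps) after `i` steps. -/
def ht (s : List ℤ) (i : ℕ) : ℤ := (s.take i).sum

/-- A basketball walk: every step lies in `{-2, -1, 1, 2}`. -/
def IsBasketball (s : List ℤ) : Prop := ∀ x ∈ s, x = -2 ∨ x = -1 ∨ x = 1 ∨ x = 2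

/-- A C-walk: a basketball walk from 0 to 0 that visits 1 and is positive
except at its extremities. -/
def IsCWalk (s : List ℤ) : Prop :=
  IsBasketball s ∧ ht s s.length = 0 ∧
    (∀ i, 0 < i → i < s.length → 0 < ht s i) ∧ ∃ i, i ≤ s.length ∧ ht s i = 1

/-- A G-walk: a basketball walk from 0 to 1 that is positive except at the origin. -/
def IsGWalk (s : List ℤ) : Prop :=
  IsBasketball s ∧ ht s s.length = 1 ∧ ∀ i, 1 ≤ i → i ≤ s.length → 0 < ht s i

/-- An A-walk (basketball excursion): a nonnegative basketball walk from 0 to 0. -/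
def IsAWalk (s : List ℤ) : Prop :=
  IsBasketball s ∧ ht s s.length = 0 ∧ ∀ i, i ≤ s.length → 0 ≤ ht s i

/-- A B-walk: a basketball walk from 0 to 1 that visits 0 and 1 only at its extremities. -/
def IsBWalk (s : List ℤ) : Prop :=
  IsBasketball s ∧ ht s s.length = 1 ∧
    ∀ i, 0 < i → i < s.length → ht s i ≠ 0 ∧ ht s i ≠ 1

/-- Number of `±1`-steps of a walk. -/
noncomputable def pmOneSteps (s : List ℤ) : ℕ :=
  Set.ncard {i : ℕ | i < s.length ∧ (s.getD i 0 = 1 ∨ s.getD i 0 = -1)}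

/-- Number of steps that are odd `+2`-steps or even `-2`-steps
(the step of index `i`, 0-based, starts at height `ht s i`). -/
noncomputable def lSteps (s : List ℤ) : ℕ :=
  Set.ncard {i : ℕ | i < s.length ∧
    ((s.getD i 0 = 2 ∧ Odd (ht s i)) ∨ (s.getD i 0 = -2 ∧ Even (ht s i)))}

/-- Number of steps that are odd `-2`-steps or even `+2`-steps. -/
noncomputable def rSteps (s : List ℤ) : ℕ :=
  Set.ncard {i : ℕ | i < s.length ∧
    ((s.getD i 0 = -2 ∧ Odd (ht s i)) ∨ (s.getD i 0 = 2 ∧ Even (ht s i)))}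

/-- The (0-based) steps of indices `i < j` are paired: the `i`-th step is a `+2`,
the `j`-th step is a `-2`, the walk after step `j` is back at the height it had before
step `i`, and strictly in between the walk stays at least one above that height. -/
def Paired (s : List ℤ) (i j : ℕ) : Prop :=
  i < j ∧ j < s.length ∧ s.getD i 0 = 2 ∧ s.getD j 0 = -2 ∧
    ht s (j + 1) = ht s i ∧ ∀ k, i + 1 < k → k ≤ j → ht s i + 1 ≤ ht s k

/-- A staggered `±2`-step: a `±2`-step that is not paired with any other `±2`-step. -/
def IsStaggered (s : List ℤ) (i : ℕ) : Prop :=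
  i < s.length ∧ (s.getD i 0 = 2 ∨ s.getD i 0 = -2) ∧
    (∀ j, ¬ Paired s i j) ∧ ∀ j, ¬ Paired s j i

/-- Number of staggered `±2`-steps of a walk. -/
noncomputable def staggeredCount (s : List ℤ) : ℕ :=
  Set.ncard {i : ℕ | IsStaggered s i}
/-- A sequence (list) avoids the pattern 213. -/
def Avoids213 (s : List ℕ) : Prop :=
  ∀ i1 i2 i3, i1 < i2 → i2 < i3 → i3 < s.length →
    ¬ (s.getD i2 0 < s.getD i1 0 ∧ s.getD i1 0 < s.getD i3 0)
/-- A Motzkin walk: every step lies in `{-1, 0, 1}`. -/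
def IsMotzkin (s : List ℤ) : Prop := ∀ x ∈ s, x = -1 ∨ x = 0 ∨ x = 1

/-- Index `i` starts a descending sequence (maximal run of `-1`-steps). -/
def IsRunStart (s : List ℤ) (i : ℕ) : Prop :=
  i < s.length ∧ s.getD i 0 = -1 ∧ (i = 0 ∨ s.getD (i - 1) 0 ≠ -1)

/-- Length of the run of consecutive `-1`-steps starting at index `i`. -/
noncomputable def runLen (s : List ℤ) (i : ℕ) : ℕ :=
  Set.ncard {j : ℕ | i ≤ j ∧ j < s.length ∧ ∀ k, i ≤ k → k ≤ j → s.getD k 0 = -1}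

/-- A decorated Motzkin walk: a Motzkin walk together with, for each descending
sequence of length `ℓ`, a 213-avoiding permutation of size `ℓ + 1` (the decoration
function is `[]` away from starts of descending sequences). -/
def IsDecorated (s : List ℤ) (dec : ℕ → List ℕ) : Prop :=
  IsMotzkin s ∧
    (∀ i, IsRunStart s i →
      (dec i).Perm (List.range' 1 (runLen s i + 1)) ∧ Avoids213 (dec i)) ∧
    ∀ i, ¬ IsRunStart s i → dec i = []

/-- The last step of value 0 or +1 of the walk is a `+1`-step. -/
def LastUpIsPlus (s : List ℤ) : Prop :=
  ∃ i, i < s.length ∧ s.getD i 0 = 1 ∧ ∀ k, i < k → k < s.length → s.getD k 0 = -1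

/-- Number of `0`-steps of a walk. -/
noncomputable def zeroSteps (s : List ℤ) : ℕ :=
  Set.ncard {i : ℕ | i < s.length ∧ s.getD i 0 = 0}

namespace BasketballWalk

open PowerSeries

/-- A contraction for the `X`-adic topology on pairs of power series has a fixed point. -/
theorem exists_fixedPoint_of_contraction {R : Type*} [CommRing R] (Φ : R⟦X⟧ × R⟦X⟧ → R⟦X⟧ × R⟦X⟧)
    (hΦ : ∀ n f g, (X, X) ^ n ∣ f - g → (X, X) ^ (n + 1) ∣ Φ f - Φ g) : ∃ f, Φ f = f := by
  have key : ∀ (n : ℕ) (f g : R⟦X⟧ × R⟦X⟧), (X, X) ^ n ∣ f - g ↔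
      (∀ m < n, coeff m f.1 = coeff m g.1) ∧ ∀ m < n, coeff m f.2 = coeff m g.2 := by
    intro n f g
    have : (X, X) ^ n ∣ f - g ↔ X ^ n ∣ (f - g).1 ∧ X ^ n ∣ (f - g).2 := by
      constructor
      · rintro ⟨c, hc⟩
        rw [hc]
        exact ⟨⟨c.1, rfl⟩, ⟨c.2, rfl⟩⟩
      · rintro ⟨⟨c, hc⟩, ⟨d, hd⟩⟩
        exact ⟨(c, d), Prod.ext hc hd⟩
    rw [this, X_pow_dvd_iff, X_pow_dvd_iff]
    simp [sub_eq_zero]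
  set F : ℕ → R⟦X⟧ × R⟦X⟧ := fun k => Φ^[k] 0 with hF
  have hsucc : ∀ k, F (k + 1) = Φ (F k) := fun k => Function.iterate_succ_apply' Φ k 0
  have hstep : ∀ k, (X, X) ^ k ∣ F (k + 1) - F k := by
    intro k
    induction k with
    | zero => simp
    | succ k ih =>
      have := hΦ k _ _ ih
      rwa [← hsucc, ← hsucc] at this
  have hmono : ∀ k l, k ≤ l → (X, X) ^ k ∣ F l - F k := by
    intro k l hkl
    induction l, hkl using Nat.le_induction with
    | base => simp
    | succ l hkl ih =>
      have := dvd_add ((pow_dvd_pow _ hkl).trans (hstep l)) ih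
      simpa using this
  set f : R⟦X⟧ × R⟦X⟧ :=
    (mk fun n => coeff n (F (n + 1)).1, mk fun n => coeff n (F (n + 1)).2) with hf
  have hlim : ∀ n, (X, X) ^ n ∣ f - F n := by
    intro n
    rw [key]
    constructor <;> intro m hm
    · simpa [hf] using (((key _ _ _).1 (hmono (m + 1) n hm)).1 m (Nat.lt_succ_self m)).symm
    · simpa [hf] using (((key _ _ _).1 (hmono (m + 1) n hm)).2 m (Nat.lt_succ_self m)).symm
  have hfix : ∀ n, (X, X) ^ (n + 1) ∣ Φ f - f := by
    intro n
    have h1 := hΦ n _ _ (hlim n)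
    have h2 := hlim (n + 1)
    rw [hsucc] at h2
    have := dvd_sub h1 h2
    simpa using this
  refine ⟨f, Prod.ext ?_ ?_⟩ <;> ext1 n
  · exact ((key _ _ _).1 (hfix n)).1 n (Nat.lt_succ_self n)
  · exact ((key _ _ _).1 (hfix n)).2 n (Nat.lt_succ_self n)

/-- The variable marking staggered steps, respectively `0`-steps. -/
noncomputable abbrev mark : Polynomial ℤ := Polynomial.X

/-- The algebraic system satisfied by the generating functions `A` of excursions and `P` of
first passages one level down. -/
structure IsWalkSystem (A P : (Polynomial ℤ)⟦X⟧) : Prop where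
  excursion : A = (1 + X * A * P) ^ 2
  passage : P = X * A * (1 + C mark * P)

theorem exists_isWalkSystem : ∃ A P, IsWalkSystem A P := by
  obtain ⟨⟨A, P⟩, h⟩ := exists_fixedPoint_of_contraction
    (R := Polynomial ℤ) (fun f => ((1 + X * f.1 * f.2) ^ 2, X * f.1 * (1 + C mark * f.2))) <| by
      rintro n ⟨a, p⟩ ⟨b, q⟩ ⟨⟨c, d⟩, h⟩
      have h1 : a = b + X ^ n * c := by
        have := congrArg Prod.fst h
        simp only [Prod.fst_sub, Prod.fst_mul, Prod.pow_fst] at this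
        exact sub_eq_iff_eq_add'.1 this
      have h2 : p = q + X ^ n * d := by
        have := congrArg Prod.snd h
        simp only [Prod.snd_sub, Prod.snd_mul, Prod.pow_snd] at this
        exact sub_eq_iff_eq_add'.1 this
      subst h1 h2
      refine ⟨((c * (q + X ^ n * d) + b * d) *
        (2 + X * (b + X ^ n * c) * (q + X ^ n * d) + X * b * q),
        c * (1 + C mark * (q + X ^ n * d)) + b * C mark * d), ?_⟩
      apply Prod.ext
      · change _ = X ^ (n + 1) * _
        simp only [Prod.fst_sub]
        ring
      · change _ = X ^ (n + 1) * _
        simp only [Prod.snd_sub]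
        ring
  exact ⟨A, P, (congrArg Prod.fst h).symm, (congrArg Prod.snd h).symm⟩

/-- All lists of length `n` with entries in `S`. -/
def stepLists (S : Finset ℤ) : ℕ → Finset (List ℤ)
  | 0 => {[]}
  | n + 1 => (S ×ˢ stepLists S n).image fun p => p.1 :: p.2

theorem mem_stepLists {S : Finset ℤ} {n : ℕ} {s : List ℤ} :
    s ∈ stepLists S n ↔ s.length = n ∧ ∀ x ∈ s, x ∈ S := by
  induction n generalizing s with
  | zero => simp +contextual [stepLists]
  | succ n ih =>
    cases s with
    | nil => simp [stepLists]
    | cons x s =>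
      simp only [stepLists, Finset.mem_image, Finset.mem_product, Prod.exists,
        List.cons.injEq, ih, List.length_cons, List.mem_cons,
        forall_eq_or_imp, Nat.add_right_cancel_iff]
      constructor
      · rintro ⟨a, b, ⟨ha, hb, hc⟩, rfl, rfl⟩
        exact ⟨hb, ha, hc⟩
      · rintro ⟨hb, ha, hc⟩
        exact ⟨x, s, ⟨ha, hb, hc⟩, rfl, rfl⟩

theorem sum_stepLists_succ {M : Type*} [AddCommMonoid M] (S : Finset ℤ) (n : ℕ)
    (f : List ℤ → M) :
    ∑ t ∈ stepLists S (n + 1), f t = ∑ x ∈ S, ∑ t ∈ stepLists S n, f (x :: t) := by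
  rw [stepLists, Finset.sum_image (fun p _ q _ h => by simpa [Prod.ext_iff] using h),
    Finset.sum_product]

theorem sum_stepLists_reverse {M : Type*} [AddCommMonoid M] (S : Finset ℤ) (n : ℕ)
    (f : List ℤ → M) :
    ∑ t ∈ stepLists S n, f t.reverse = ∑ t ∈ stepLists S n, f t :=
  Finset.sum_bij' (fun t _ => t.reverse) (fun t _ => t.reverse)
    (fun t ht => by simpa [mem_stepLists] using ht)
    (fun t ht => by simpa [mem_stepLists] using ht)
    (fun t _ => t.reverse_reverse) (fun t _ => t.reverse_reverse) (fun _ _ => rfl)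

/-- Weight of a level crossed by a step that is not the second level of a `+2`-step: `true`
records that the level is later crossed downwards by the lower half of a `-2`-step, which is then
staggered. -/
noncomputable def upWeight (b : Bool) : Polynomial ℤ := if b then mark else 1

/-- Weight of the lower level crossed by a `+2`-step, which is paired exactly when the level is
marked by `true`. -/
noncomputable def lowWeight (b : Bool) : Polynomial ℤ := if b then 1 else mark

/-- Weight of a list of steps read backwards from the height `σ.length`, where `σ` records for each
level (topmost first) whether it is next crossed by the lower half of a `-2`-step. -/
noncomputable def backWeight : List Bool → List ℤ → Polynomial ℤ
  | [], [] => 1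
  | _ :: _, [] => 0
  | σ, x :: t =>
    if x = -1 then backWeight (false :: σ) t
    else if x = -2 then backWeight (false :: true :: σ) t
    else if x = 1 then
      match σ with
      | [] => 0
      | b :: τ => upWeight b * backWeight τ t
    else if x = 2 then
      match σ with
      | b :: c :: τ => upWeight b * lowWeight c * backWeight τ t
      | _ => 0
    else 0

/-- The generating function of `backWeight σ`, together with the one for walks starting with
the lower half of a `+2`-step. -/
noncomputable def backSeries (A P : (Polynomial ℤ)⟦X⟧) :
    List Bool → (Polynomial ℤ)⟦X⟧ × (Polynomial ℤ)⟦X⟧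
  | [] => (A, 0)
  | false :: σ => (P * (backSeries A P σ).1 + X * A * (backSeries A P σ).2,
      C mark * (backSeries A P σ).1)
  | true :: σ => ((C mark * X * A + X * A * P) * (backSeries A P σ).1 +
      C mark * X * A * (backSeries A P σ).2, (backSeries A P σ).1)

theorem backSeries_cons_snd (A P : (Polynomial ℤ)⟦X⟧) (b : Bool) (σ : List Bool) :
    (backSeries A P (b :: σ)).2 = C (lowWeight b) * (backSeries A P σ).1 := by
  cases b <;> simp [backSeries, lowWeight]

theorem backSeries_nil_fst {A P : (Polynomial ℤ)⟦X⟧} (h : IsWalkSystem A P) :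
    (backSeries A P []).1 =
      1 + X * ((backSeries A P [false]).1 + (backSeries A P [false, true]).1) := by
  have hE := h.excursion
  have hP := h.passage
  simp only [backSeries]
  linear_combination hE + X * A * hP

theorem backSeries_cons_fst {A P : (Polynomial ℤ)⟦X⟧} (h : IsWalkSystem A P) (b : Bool)
    (σ : List Bool) :
    (backSeries A P (b :: σ)).1 = X * ((backSeries A P (false :: b :: σ)).1 +
      (backSeries A P (false :: true :: b :: σ)).1 +
      C (upWeight b) * ((backSeries A P σ).1 + (backSeries A P σ).2)) := by
  have hE := h.excursion
  have hP := h.passage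
  generalize hf : (backSeries A P σ).1 = f
  generalize hg : (backSeries A P σ).2 = g
  cases b
  · simp only [backSeries, upWeight, hf, hg, map_one, Bool.false_eq_true, if_false]
    linear_combination (f - X * (2 * P + X * A * P ^ 2) * f + X * (P * f + X * A * g) +
      X * C mark * f) * hP + X * ((1 + C mark * P) * f + g) * hE
  · simp only [backSeries, upWeight, hf, hg, if_true]
    linear_combination X * (C mark * f + P * f + C mark * g) * hE +
      X * (X * A * (C mark * f + P * f + C mark * g) + f) * hP

theorem sum_backWeight {A P : (Polynomial ℤ)⟦X⟧} (h : IsWalkSystem A P) (n : ℕ) (σ : List Bool) :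
    ∑ t ∈ stepLists {-2, -1, 1, 2} n, backWeight σ t = coeff n (backSeries A P σ).1 := by
  induction n generalizing σ with
  | zero =>
    cases σ with
    | nil => simp [stepLists, backWeight, backSeries_nil_fst h]
    | cons b σ =>
      rw [backSeries_cons_fst h]
      simp [stepLists, backWeight]
  | succ n ih =>
    rw [sum_stepLists_succ]
    cases σ with
    | nil =>
      rw [backSeries_nil_fst h, map_add, coeff_one, if_neg n.succ_ne_zero]
      simp [backWeight, ih]
      ring
    | cons b σ =>
      rw [backSeries_cons_fst h]
      cases σ with
      | nil =>
        simp [backWeight, ih, ← Finset.mul_sum, coeff_C_mul, backSeries]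
        ring
      | cons c σ =>
        rw [backSeries_cons_snd]
        simp [backWeight, ih, ← Finset.mul_sum, coeff_C_mul]
        ring

/-- The tail `∑ catalan (r + l) * x ^ l` of the Catalan series at `x = X * P`. -/
noncomputable def catalanTail (P : (Polynomial ℤ)⟦X⟧) (r : ℕ) : (Polynomial ℤ)⟦X⟧ :=
  (mk fun l => (catalan (r + l) : Polynomial ℤ)).subst (X * P)

theorem hasSubst_X_mul (P : (Polynomial ℤ)⟦X⟧) : HasSubst (X * P) :=
  HasSubst.of_constantCoeff_zero' (by simp)

theorem catalanTail_eq_add (P : (Polynomial ℤ)⟦X⟧) (r : ℕ) :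
    catalanTail P r = C (catalan r : Polynomial ℤ) + X * P * catalanTail P (r + 1) := by
  have h : (mk fun l => (catalan (r + l) : Polynomial ℤ)) =
      C (catalan r : Polynomial ℤ) + X * mk fun l => (catalan (r + 1 + l) : Polynomial ℤ) := by
    ext1 n
    cases n with
    | zero => simp
    | succ n =>
      rw [map_add, coeff_succ_X_mul, coeff_C, if_neg n.succ_ne_zero]
      simp [Nat.add_assoc, Nat.add_comm 1 n]
  have hs := hasSubst_X_mul P
  rw [catalanTail, h, subst_add hs, subst_mul hs, subst_X hs, subst_C]
  rfl

theorem catalanTail_one (P : (Polynomial ℤ)⟦X⟧) : catalanTail P 1 = catalanTail P 0 ^ 2 := by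
  have h : (mk fun l => (catalan (1 + l) : Polynomial ℤ)) =
      (mk fun l => (catalan (0 + l) : Polynomial ℤ)) ^ 2 := by
    ext1 n
    rw [sq, coeff_mul, coeff_mk, Nat.add_comm, catalan_succ']
    simp
  have hs := hasSubst_X_mul P
  rw [catalanTail, h, subst_pow hs, catalanTail]

theorem catalanTail_one_eq {A P : (Polynomial ℤ)⟦X⟧} (h : IsWalkSystem A P) :
    catalanTail P 1 = A := by
  have h0 := catalanTail_eq_add P 0
  rw [catalanTail_one] at h0 ⊢
  generalize catalanTail P 0 = D at *
  have hE := h.excursion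
  simp only [catalan_zero, Nat.cast_one, map_one] at h0
  have hz : (D - (1 + X * A * P)) * (1 - X * P * (D + (1 + X * A * P))) = 0 := by
    linear_combination h0 - X * P * hE
  have hne : (1 - X * P * (D + (1 + X * A * P)) : (Polynomial ℤ)⟦X⟧) ≠ 0 := by
    intro hc
    simpa using congrArg constantCoeff hc
  have := (mul_eq_zero.1 hz).resolve_right hne
  rw [sub_eq_zero.1 this, ← hE]

/-- Weight of a list of Motzkin steps read backwards from height `h` down to `0`, given that the
last `r` steps read were `-1`-steps. -/
noncomputable def motzkinWeight : ℕ → ℕ → List ℤ → Polynomial ℤ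
  | h, _, [] => if h = 0 then 1 else 0
  | h, r, x :: t =>
    if h = 0 then 0
    else if x = -1 then motzkinWeight (h + 1) (r + 1) t
    else if x = 0 then catalan (r + 1) * mark * motzkinWeight h 0 t
    else if x = 1 then catalan (r + 1) * motzkinWeight (h - 1) 0 t
    else 0

/-- Weight of a list of Motzkin steps read backwards from height `1` down to `0`, given that `r`
steps, all of value `-1`, have been read, and that the first step of another value is `+1`. -/
noncomputable def startWeight : ℕ → List ℤ → Polynomial ℤ
  | _, [] => 0
  | r, x :: t =>
    if x = -1 then startWeight (r + 1) t
    else if x = 1 then catalan (r + 1) * motzkinWeight r 0 t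
    else 0

/-- The generating function of `motzkinWeight h r`. -/
noncomputable def motzkinSeries (P : (Polynomial ℤ)⟦X⟧) : ℕ → ℕ → (Polynomial ℤ)⟦X⟧
  | 0, _ => 1
  | h + 1, r => X * P ^ h * (1 + C mark * P) * catalanTail P (r + 1)

theorem motzkinSeries_zero_right {A P : (Polynomial ℤ)⟦X⟧} (h : IsWalkSystem A P) (k : ℕ) :
    motzkinSeries P k 0 = P ^ k := by
  cases k with
  | zero => rfl
  | succ k =>
    have hP := h.passage
    rw [motzkinSeries, catalanTail_one_eq h]
    linear_combination (-P ^ k) * hP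

theorem motzkinSeries_succ {A P : (Polynomial ℤ)⟦X⟧} (h : IsWalkSystem A P) (k r : ℕ) :
    motzkinSeries P (k + 1) r = X * (motzkinSeries P (k + 2) (r + 1) +
      C (catalan (r + 1) * mark) * motzkinSeries P (k + 1) 0 +
      C (catalan (r + 1) : Polynomial ℤ) * motzkinSeries P k 0) := by
  rw [motzkinSeries_zero_right h, motzkinSeries_zero_right h, motzkinSeries, motzkinSeries,
    catalanTail_eq_add P (r + 1), map_mul]
  ring

theorem sum_motzkinWeight {A P : (Polynomial ℤ)⟦X⟧} (hs : IsWalkSystem A P) (n h r : ℕ) :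
    ∑ t ∈ stepLists {-1, 0, 1} n, motzkinWeight h r t = coeff n (motzkinSeries P h r) := by
  induction n generalizing h r with
  | zero =>
    cases h with
    | zero => simp [stepLists, motzkinWeight, motzkinSeries]
    | succ h =>
      rw [motzkinSeries_succ hs]
      simp [stepLists, motzkinWeight]
  | succ n ih =>
    rw [sum_stepLists_succ]
    cases h with
    | zero =>
      rw [motzkinSeries, coeff_one, if_neg n.succ_ne_zero]
      simp [motzkinWeight]
    | succ h =>
      rw [motzkinSeries_succ hs, coeff_succ_X_mul, map_add, map_add, coeff_C_mul, coeff_C_mul,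
        ← ih, ← ih, ← ih, Finset.mul_sum, Finset.mul_sum]
      simp [motzkinWeight]
      ring

theorem sum_startWeight {A P : (Polynomial ℤ)⟦X⟧} (hs : IsWalkSystem A P) (n r : ℕ) :
    ∑ t ∈ stepLists {-1, 0, 1} n, startWeight r t =
      coeff n (X * P ^ r * catalanTail P (r + 1)) := by
  induction n generalizing r with
  | zero => simp [stepLists, startWeight, mul_assoc]
  | succ n ih =>
    have key : X * P ^ r * catalanTail P (r + 1) = X * (X * P ^ (r + 1) * catalanTail P (r + 2) +
        C (catalan (r + 1) : Polynomial ℤ) * motzkinSeries P r 0) := by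
      rw [motzkinSeries_zero_right hs, catalanTail_eq_add P (r + 1)]
      ring
    rw [sum_stepLists_succ, key, coeff_succ_X_mul, map_add, coeff_C_mul, ← ih,
      ← sum_motzkinWeight hs, Finset.mul_sum]
    simp [startWeight]

theorem sum_startWeight_eq_sum_backWeight (n : ℕ) :
    ∑ t ∈ stepLists {-1, 0, 1} (n + 1), startWeight 0 t =
      ∑ t ∈ stepLists {-2, -1, 1, 2} n, backWeight [] t := by
  obtain ⟨A, P, h⟩ := exists_isWalkSystem
  rw [sum_startWeight h, sum_backWeight h, pow_zero, mul_one, coeff_succ_X_mul,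
    catalanTail_one_eq h, backSeries]

theorem ncard_eq_add_ncard_succ {A : Set ℕ} (hA : A.Finite) :
    A.ncard = (open Classical in if 0 ∈ A then 1 else 0) + {i | i + 1 ∈ A}.ncard := by
  classical
  have hinj : Function.Injective Nat.succ := Nat.succ_injective
  have himg : (Set.image Nat.succ {i | i + 1 ∈ A}).ncard = {i | i + 1 ∈ A}.ncard :=
    Set.ncard_image_of_injective _ hinj
  have hfin : (Set.image Nat.succ {i | i + 1 ∈ A}).Finite :=
    hA.subset (by rintro _ ⟨i, hi, rfl⟩; exact hi)
  by_cases h0 : 0 ∈ A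
  · have : A = insert 0 (Set.image Nat.succ {i | i + 1 ∈ A}) := by
      ext i
      cases i <;> simp [h0]
    rw [if_pos h0, ← himg, this, Set.ncard_insert_of_notMem (by simp) (this ▸ hfin), ← this]
    exact add_comm _ _
  · have : A = Set.image Nat.succ {i | i + 1 ∈ A} := by
      ext i
      cases i <;> simp [h0]
    rw [if_neg h0, ← himg, ← this, zero_add]

theorem finite_of_forall_lt_length {s : List ℤ} {A : Set ℕ} (h : ∀ i ∈ A, i < s.length) :
    A.Finite :=
  (Set.finite_lt_nat s.length).subset h

theorem ht_zero (s : List ℤ) : ht s 0 = 0 := rfl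

theorem ht_cons_succ (x : ℤ) (s : List ℤ) (i : ℕ) : ht (x :: s) (i + 1) = x + ht s i := by
  simp [ht]

theorem ht_length (s : List ℤ) : ht s s.length = s.sum := by simp [ht]

theorem ht_add_sum_drop (s : List ℤ) (i : ℕ) : ht s i + (s.drop i).sum = s.sum := by
  rw [ht, ← List.sum_append, List.take_append_drop]

/-- Step `j` is a `-2`-step ending at height `-k - 1`, and no earlier height is below `-k`. -/
def CrossesAt (s : List ℤ) (k : ℤ) (j : ℕ) : Prop :=
  j < s.length ∧ s.getD j 0 = -2 ∧ ht s (j + 1) = -k - 1 ∧ ∀ i ≤ j, -k ≤ ht s i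

theorem crossesAt_cons_zero (x : ℤ) (s : List ℤ) (k : ℤ) :
    CrossesAt (x :: s) k 0 ↔ x = -2 ∧ k = 1 := by
  simp only [CrossesAt, List.length_cons, List.getD_cons_zero, ht_cons_succ, ht_zero,
    Nat.le_zero_eq, forall_eq]
  omega

theorem crossesAt_cons_succ (x : ℤ) (s : List ℤ) (k : ℤ) (j : ℕ) :
    CrossesAt (x :: s) k (j + 1) ↔ 0 ≤ k ∧ CrossesAt s (k + x) j := by
  simp only [CrossesAt, List.length_cons, List.getD_cons_succ, ht_cons_succ]
  constructor
  · rintro ⟨h1, h2, h3, h4⟩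
    have h0 := h4 0 (Nat.zero_le _)
    rw [ht_zero] at h0
    refine ⟨by omega, by omega, h2, by omega, fun i hi => ?_⟩
    have := h4 (i + 1) (by omega)
    rw [ht_cons_succ] at this
    omega
  · rintro ⟨h0, h1, h2, h3, h4⟩
    refine ⟨by omega, h2, by omega, fun i hi => ?_⟩
    cases i with
    | zero => rw [ht_zero]; omega
    | succ i =>
      have := h4 i (by omega)
      rw [ht_cons_succ]
      omega

/-- The level between `-k` and `-k - 1` is first crossed by the lower half of a `-2`-step. -/
def Crosses (s : List ℤ) (k : ℤ) : Prop := ∃ j, CrossesAt s k j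

theorem crosses_cons (x : ℤ) (s : List ℤ) (k : ℤ) :
    Crosses (x :: s) k ↔ (x = -2 ∧ k = 1) ∨ (0 ≤ k ∧ Crosses s (k + x)) := by
  constructor
  · rintro ⟨j, hj⟩
    cases j with
    | zero => exact Or.inl ((crossesAt_cons_zero x s k).1 hj)
    | succ j =>
      obtain ⟨h0, h⟩ := (crossesAt_cons_succ x s k j).1 hj
      exact Or.inr ⟨h0, j, h⟩
  · rintro (h | ⟨h0, j, h⟩)
    · exact ⟨0, (crossesAt_cons_zero x s k).2 h⟩
    · exact ⟨j + 1, (crossesAt_cons_succ x s k j).2 ⟨h0, h⟩⟩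

theorem CrossesAt.nonneg {s : List ℤ} {k : ℤ} {j : ℕ} (h : CrossesAt s k j) : 0 ≤ k := by
  have := h.2.2.2 0 (Nat.zero_le _)
  rw [ht_zero] at this
  omega

theorem CrossesAt.unique {s : List ℤ} {k : ℤ} {i j : ℕ} (hi : CrossesAt s k i)
    (hj : CrossesAt s k j) : i = j := by
  obtain ⟨-, -, hi, hi'⟩ := hi
  obtain ⟨-, -, hj, hj'⟩ := hj
  rcases lt_trichotomy i j with h | h | h
  · have := hj' (i + 1) h
    omega
  · exact h
  · have := hi' (j + 1) h
    omega

theorem paired_cons_succ_succ (x : ℤ) (s : List ℤ) (i j : ℕ) :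
    Paired (x :: s) (i + 1) (j + 1) ↔ Paired s i j := by
  simp only [Paired, List.length_cons, List.getD_cons_succ, ht_cons_succ]
  constructor
  · rintro ⟨h1, h2, h3, h4, h5, h6⟩
    refine ⟨by omega, by omega, h3, h4, by omega, fun k hk hk' => ?_⟩
    have := h6 (k + 1) (by omega) (by omega)
    rw [ht_cons_succ] at this
    omega
  · rintro ⟨h1, h2, h3, h4, h5, h6⟩
    refine ⟨by omega, by omega, h3, h4, by omega, fun k hk hk' => ?_⟩
    obtain ⟨k, rfl⟩ : ∃ l, k = l + 1 := ⟨k - 1, by omega⟩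
    have := h6 k (by omega) (by omega)
    rw [ht_cons_succ]
    omega

theorem not_paired_zero_right (s : List ℤ) (i : ℕ) : ¬ Paired s i 0 := fun h => by
  have := h.1
  omega

theorem paired_cons_zero_succ (x : ℤ) (s : List ℤ) (j : ℕ) :
    Paired (x :: s) 0 (j + 1) ↔ x = 2 ∧ CrossesAt s 1 j := by
  simp only [Paired, CrossesAt, List.length_cons, List.getD_cons_succ, List.getD_cons_zero,
    ht_cons_succ, ht_zero]
  constructor
  · rintro ⟨h1, h2, rfl, h4, h5, h6⟩
    refine ⟨rfl, by omega, h4, by omega, fun k hk => ?_⟩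
    cases k with
    | zero => rw [ht_zero]; omega
    | succ k =>
      have := h6 (k + 2) (by omega) (by omega)
      rw [ht_cons_succ] at this
      omega
  · rintro ⟨rfl, h2, h4, h5, h6⟩
    refine ⟨by omega, by omega, rfl, h4, by omega, fun k hk hk' => ?_⟩
    obtain ⟨k, rfl⟩ : ∃ l, k = l + 1 := ⟨k - 1, by omega⟩
    have := h6 k (by omega)
    rw [ht_cons_succ]
    omega

theorem isStaggered_cons_zero (x : ℤ) (s : List ℤ) :
    IsStaggered (x :: s) 0 ↔ x = -2 ∨ (x = 2 ∧ ¬ Crosses s 1) := by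
  have h1 : (∀ j, ¬ Paired (x :: s) 0 j) ↔ ¬ (x = 2 ∧ Crosses s 1) := by
    constructor
    · rintro h ⟨hx, j, hj⟩
      exact h (j + 1) ((paired_cons_zero_succ x s j).2 ⟨hx, hj⟩)
    · intro h j hj
      cases j with
      | zero => exact not_paired_zero_right _ _ hj
      | succ j =>
        obtain ⟨hx, hj⟩ := (paired_cons_zero_succ x s j).1 hj
        exact h ⟨hx, j, hj⟩
  simp only [IsStaggered, h1, not_paired_zero_right, List.length_cons, List.getD_cons_zero]
  constructor
  · rintro ⟨-, rfl | rfl, h, -⟩ <;> simp_all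
  · rintro (rfl | ⟨rfl, h⟩) <;> simp_all

theorem isStaggered_cons_succ (x : ℤ) (s : List ℤ) (i : ℕ) :
    IsStaggered (x :: s) (i + 1) ↔ IsStaggered s i ∧ ¬ (x = 2 ∧ CrossesAt s 1 i) := by
  have h1 : (∀ j, ¬ Paired (x :: s) (i + 1) j) ↔ ∀ j, ¬ Paired s i j := by
    constructor
    · intro h j hj
      exact h (j + 1) ((paired_cons_succ_succ x s i j).2 hj)
    · intro h j hj
      cases j with
      | zero => exact not_paired_zero_right _ _ hj
      | succ j => exact h j ((paired_cons_succ_succ x s i j).1 hj)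
  have h2 : (∀ j, ¬ Paired (x :: s) j (i + 1)) ↔
      (∀ j, ¬ Paired s j i) ∧ ¬ (x = 2 ∧ CrossesAt s 1 i) := by
    constructor
    · intro h
      exact ⟨fun j hj => h (j + 1) ((paired_cons_succ_succ x s j i).2 hj),
        fun hc => h 0 ((paired_cons_zero_succ x s i).2 hc)⟩
    · rintro ⟨h, hc⟩ j hj
      cases j with
      | zero => exact hc ((paired_cons_zero_succ x s i).1 hj)
      | succ j => exact h j ((paired_cons_succ_succ x s j i).1 hj)
  simp only [IsStaggered, h1, h2, List.length_cons, List.getD_cons_succ,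
    Nat.add_lt_add_iff_right]
  tauto

theorem CrossesAt.isStaggered {s : List ℤ} {i : ℕ} (h : CrossesAt s 1 i) : IsStaggered s i := by
  obtain ⟨h1, h2, h3, h4⟩ := h
  refine ⟨h1, Or.inr h2, fun j hj => ?_, fun j hj => ?_⟩
  · have := hj.2.2.1
    omega
  · have := hj.2.2.2.2.1
    have := h4 j hj.1.le
    omega

theorem finite_setOf_isStaggered (s : List ℤ) : {i | IsStaggered s i}.Finite :=
  finite_of_forall_lt_length (s := s) fun _ h => h.1

theorem staggeredCount_nil : staggeredCount [] = 0 := by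
  simp [staggeredCount, IsStaggered]

theorem staggeredCount_cons_of_crosses {s : List ℤ} (h : Crosses s 1) :
    staggeredCount (2 :: s) + 1 = staggeredCount s := by
  obtain ⟨j, hj⟩ := h
  rw [staggeredCount, ncard_eq_add_ncard_succ (finite_setOf_isStaggered _)]
  have : {i | i + 1 ∈ {i | IsStaggered (2 :: s) i}} = {i | IsStaggered s i} \ {j} := by
    ext i
    simp only [Set.mem_ofPred_eq, isStaggered_cons_succ, true_and, Set.mem_sdiff,
      Set.mem_singleton_iff]
    refine and_congr_right fun _ => not_congr ⟨fun hi => hi.unique hj, ?_⟩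
    rintro rfl
    exact hj
  rw [this, Set.mem_ofPred_eq, isStaggered_cons_zero, if_neg (by simpa using ⟨j, hj⟩), zero_add]
  exact Set.ncard_sdiff_singleton_add_one hj.isStaggered (finite_setOf_isStaggered s)

theorem staggeredCount_cons {x : ℤ} {s : List ℤ} (h : ¬ (x = 2 ∧ Crosses s 1)) :
    staggeredCount (x :: s) = staggeredCount s + if x = 2 ∨ x = -2 then 1 else 0 := by
  rw [staggeredCount, ncard_eq_add_ncard_succ (finite_setOf_isStaggered _), add_comm]
  have : {i | i + 1 ∈ {i | IsStaggered (x :: s) i}} = {i | IsStaggered s i} := by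
    ext i
    simp only [Set.mem_ofPred_eq, isStaggered_cons_succ]
    exact and_iff_left fun hi => h ⟨hi.1, i, hi.2⟩
  rw [this, staggeredCount, Set.mem_ofPred_eq, isStaggered_cons_zero]
  have hiff : x = -2 ∨ (x = 2 ∧ ¬ Crosses s 1) ↔ x = 2 ∨ x = -2 := by tauto
  by_cases hx : x = 2 ∨ x = -2
  · rw [if_pos hx, if_pos (hiff.2 hx)]
  · rw [if_neg hx, if_neg (hx ∘ hiff.1)]

theorem isAWalk_iff (s : List ℤ) :
    IsAWalk s ↔ IsBasketball s ∧ s.sum = 0 ∧ ∀ i, (s.drop i).sum ≤ 0 := by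
  rw [IsAWalk, ht_length]
  refine and_congr_right fun _ => and_congr_right fun h0 => ⟨fun h i => ?_, fun h i _ => ?_⟩
  · rcases le_total i s.length with hi | hi
    · have := h i hi
      have := ht_add_sum_drop s i
      omega
    · simp [List.drop_eq_nil_of_le hi]
  · have := h i
    have := ht_add_sum_drop s i
    omega

theorem not_isAWalk_of_sum_pos {l s : List ℤ} (h : 0 < s.sum) : ¬ IsAWalk (l ++ s) := by
  rw [isAWalk_iff]
  rintro ⟨-, -, h'⟩
  have := h' l.length
  rw [List.drop_left] at this
  omega

/-- The weight of `s` as a basketball excursion, zero if `s` is not one. -/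
noncomputable def excursionWeight (s : List ℤ) : Polynomial ℤ :=
  open Classical in if IsAWalk s then mark ^ staggeredCount s else 0

/-- `s` is the end of a basketball excursion, starting from height `σ.length`, and `σ` records
which levels below are first crossed by the lower half of a `-2`-step. -/
structure IsBackState (s : List ℤ) (σ : List Bool) : Prop where
  basketball : IsBasketball s
  drop_sum_nonpos : ∀ i, (s.drop i).sum ≤ 0
  sum_eq : s.sum = -σ.length
  crosses : ∀ (k : ℕ) (b : Bool), σ[k]? = some b → (b = true ↔ Crosses s k)

theorem isBackState_nil : IsBackState [] [] :=
  ⟨by simp [IsBasketball], by simp, by simp, by simp⟩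

theorem IsBackState.cons {s : List ℤ} {σ τ : List Bool} {x : ℤ} (h : IsBackState s σ)
    (hx : x = -2 ∨ x = -1 ∨ x = 1 ∨ x = 2) (hτ : (τ.length : ℤ) = σ.length - x)
    (hc : ∀ (k : ℕ) (b : Bool), τ[k]? = some b → (b = true ↔ Crosses (x :: s) k)) :
    IsBackState (x :: s) τ := by
  have hsum : (x :: s).sum = -τ.length := by
    rw [List.sum_cons, h.sum_eq]
    omega
  refine ⟨fun y hy => ?_, fun i => ?_, hsum, hc⟩
  · rcases List.mem_cons.1 hy with rfl | hy
    · exact hx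
    · exact h.basketball y hy
  · cases i with
    | zero => rw [List.drop_zero, hsum]; omega
    | succ i => exact h.drop_sum_nonpos i

theorem not_crosses_of_neg {s : List ℤ} {k : ℤ} (hk : k < 0) : ¬ Crosses s k := fun ⟨_, h⟩ => by
  have := h.nonneg
  omega

theorem backWeight_cons_neg_one (σ : List Bool) (t : List ℤ) :
    backWeight σ (-1 :: t) = backWeight (false :: σ) t := by
  cases σ <;> simp [backWeight]

theorem backWeight_cons_neg_two (σ : List Bool) (t : List ℤ) :
    backWeight σ (-2 :: t) = backWeight (false :: true :: σ) t := by
  cases σ <;> simp [backWeight]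

theorem pow_mul_backWeight {s : List ℤ} {σ : List Bool} (h : IsBackState s σ) (t : List ℤ) :
    mark ^ staggeredCount s * backWeight σ t =
      mark ^ σ.count true * excursionWeight (t.reverse ++ s) := by
  induction t generalizing s σ with
  | nil =>
    cases σ with
    | nil =>
      have : IsAWalk s := (isAWalk_iff s).2 ⟨h.basketball, by simpa using h.sum_eq,
        h.drop_sum_nonpos⟩
      simp [backWeight, excursionWeight, this]
    | cons b σ =>
      have : ¬ IsAWalk s := fun hA => by
        have h1 := ((isAWalk_iff s).1 hA).2.1
        have h2 := h.sum_eq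
        rw [List.length_cons] at h2
        omega
      simp [backWeight, excursionWeight, this]
  | cons x t ih =>
    rw [List.reverse_cons, List.append_assoc, List.singleton_append]
    by_cases h1 : x = -1
    · subst h1
      have hst : IsBackState (-1 :: s) (false :: σ) := by
        refine h.cons (by simp) (by simp) fun k b hk => ?_
        rw [crosses_cons]
        cases k with
        | zero =>
          obtain rfl : false = b := by simpa using hk
          simpa using not_crosses_of_neg (by norm_num)
        | succ k =>
          rw [h.crosses k b (by simpa using hk)]
          simp
          omega
      have := ih hst
      rw [staggeredCount_cons (by simp)] at this
      simpa [backWeight_cons_neg_one] using this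
    by_cases h2 : x = -2
    · subst h2
      have hst : IsBackState (-2 :: s) (false :: true :: σ) := by
        refine h.cons (by simp) (by simp; ring) fun k b hk => ?_
        rw [crosses_cons]
        match k with
        | 0 =>
          obtain rfl : false = b := by simpa using hk
          simpa using not_crosses_of_neg (by norm_num)
        | 1 =>
          obtain rfl : true = b := by simpa using hk
          simp
        | k + 2 =>
          rw [h.crosses k b (by simpa using hk)]
          have : ((k + 2 : ℕ) : ℤ) + -2 = k := by push_cast; ring
          rw [this]
          exact ⟨fun hs => Or.inr ⟨by positivity, hs⟩,
            fun hs => hs.elim (fun hs => by omega) And.right⟩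
      have := ih hst
      rw [staggeredCount_cons (by simp), if_pos (Or.inr rfl)] at this
      rw [backWeight_cons_neg_two]
      refine mul_left_cancel₀ (Polynomial.X_ne_zero (R := ℤ)) ?_
      simp only [List.count_cons, beq_self_eq_true, if_true, pow_succ] at this
      simp at this
      linear_combination this
    by_cases h3 : x = 1
    · subst h3
      cases σ with
      | nil =>
        have : ¬ IsAWalk (t.reverse ++ 1 :: s) := not_isAWalk_of_sum_pos (by
          have := h.sum_eq
          rw [List.length_nil] at this
          rw [List.sum_cons]
          omega)
        simp [backWeight, excursionWeight, this]
      | cons b τ =>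
        have hst : IsBackState (1 :: s) τ := by
          refine h.cons (by simp) (by simp) fun k c hk => ?_
          rw [crosses_cons, h.crosses (k + 1) c (by simpa using hk)]
          simp
        have := ih hst
        rw [staggeredCount_cons (by simp), if_neg (by norm_num), add_zero] at this
        have hw : backWeight (b :: τ) (1 :: t) = upWeight b * backWeight τ t := by
          simp [backWeight]
        rw [hw, mul_left_comm, this, List.count_cons, pow_add, upWeight]
        cases b <;> simp
        ring
    by_cases h4 : x = 2
    · subst h4
      have hlen : σ.length < 2 → ¬ IsAWalk (t.reverse ++ 2 :: s) := fun hσ =>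
        not_isAWalk_of_sum_pos (by
          have := h.sum_eq
          rw [List.sum_cons]
          omega)
      match σ, h with
      | [], h => simp [backWeight, excursionWeight, hlen]
      | [b], h => simp [backWeight, excursionWeight, hlen]
      | b :: c :: τ, h =>
        have hst : IsBackState (2 :: s) τ := by
          refine h.cons (by simp) (by simp; ring) fun k d hk => ?_
          rw [crosses_cons, h.crosses (k + 2) d (by simpa using hk)]
          simp
        have := ih hst
        have hw : backWeight (b :: c :: τ) (2 :: t) =
            upWeight b * lowWeight c * backWeight τ t := by
          simp [backWeight]
        have hc := h.crosses 1 c (by simp)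
        rw [hw, List.count_cons, List.count_cons, pow_add, pow_add, upWeight, lowWeight]
        cases c with
        | true =>
          have hs : Crosses s 1 := by simpa using hc
          rw [← staggeredCount_cons_of_crosses hs, pow_succ]
          cases b
          · simp
            linear_combination mark * this
          · simp
            linear_combination mark ^ 2 * this
        | false =>
          have hs : ¬ Crosses s 1 := by simpa using hc
          rw [staggeredCount_cons (by simpa using hs), if_pos (by simp), pow_succ] at this
          cases b
          · simp
            linear_combination this
          · simp
            linear_combination mark * this
    have : ¬ IsAWalk (t.reverse ++ x :: s) := fun hA => by
      have := hA.1 x (by simp)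
      omega
    cases σ <;> simp [backWeight, excursionWeight, h1, h2, h3, h4, this]

theorem backWeight_nil_eq (t : List ℤ) : backWeight [] t = excursionWeight t.reverse := by
  simpa [staggeredCount_nil] using pow_mul_backWeight isBackState_nil t

theorem card_excursions (m j : ℕ) :
    (Nat.card {s : List ℤ // IsAWalk s ∧ s.length = m ∧ staggeredCount s = j} : ℤ) =
      (∑ t ∈ stepLists {-2, -1, 1, 2} m, backWeight [] t).coeff j := by
  classical
  simp only [backWeight_nil_eq]
  rw [sum_stepLists_reverse _ _ excursionWeight, Polynomial.finsetSum_coeff]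
  have hcard : Nat.card {s : List ℤ // IsAWalk s ∧ s.length = m ∧ staggeredCount s = j} =
      ((stepLists {-2, -1, 1, 2} m).filter fun s => IsAWalk s ∧ staggeredCount s = j).card := by
    refine Nat.subtype_card _ fun s => ?_
    rw [Finset.mem_filter, mem_stepLists]
    constructor
    · rintro ⟨⟨h1, -⟩, h2, h3⟩
      exact ⟨h2, h1, h3⟩
    · rintro ⟨h2, h1, h3⟩
      exact ⟨⟨h1, fun x hx => by simpa using h2.1 x hx⟩, h2, h3⟩
  rw [hcard, Finset.card_filter, Nat.cast_sum]
  refine Finset.sum_congr rfl fun s _ => ?_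
  by_cases hA : IsAWalk s
  · by_cases hj : staggeredCount s = j
    · simp [excursionWeight, hA, hj]
    · simp [excursionWeight, hA, hj, Polynomial.coeff_X_pow, Ne.symm hj]
  · simp [excursionWeight, hA]

theorem avoids213_nil : Avoids213 [] := fun _ _ _ _ _ h => by simp at h

theorem avoids213_cons (x : ℕ) (l : List ℕ) :
    Avoids213 (x :: l) ↔ l.Pairwise (fun y z => ¬ (y < x ∧ x < z)) ∧ Avoids213 l := by
  rw [List.pairwise_iff_getElem]
  constructor
  · intro h
    refine ⟨fun i j hi hj hij => ?_, fun i1 i2 i3 h1 h2 h3 => ?_⟩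
    · have := h 0 (i + 1) (j + 1) (by omega) (by omega) (by simpa using hj)
      rwa [List.getD_cons_succ, List.getD_cons_succ, List.getD_cons_zero,
        List.getD_eq_getElem _ _ hi, List.getD_eq_getElem _ _ hj] at this
    · have := h (i1 + 1) (i2 + 1) (i3 + 1) (by omega) (by omega) (by simpa using h3)
      simpa using this
  · rintro ⟨hp, h⟩ i1 i2 i3 h1 h2 h3
    obtain ⟨i2, rfl⟩ : ∃ i, i2 = i + 1 := ⟨i2 - 1, by omega⟩
    obtain ⟨i3, rfl⟩ : ∃ i, i3 = i + 1 := ⟨i3 - 1, by omega⟩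
    rw [List.length_cons] at h3
    have hi3 : i3 < l.length := by omega
    have hi2 : i2 < l.length := by omega
    cases i1 with
    | zero =>
      have := hp i2 i3 hi2 hi3 (by omega)
      rwa [List.getD_cons_succ, List.getD_cons_succ, List.getD_cons_zero,
        List.getD_eq_getElem _ _ hi2, List.getD_eq_getElem _ _ hi3]
    | succ i1 =>
      have := h i1 i2 i3 (by omega) (by omega) hi3
      simpa using this

theorem avoids213_append {q p : List ℕ} (h : ∀ y ∈ q, ∀ z ∈ p, z < y) :
    Avoids213 (q ++ p) ↔ Avoids213 q ∧ Avoids213 p := by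
  induction q with
  | nil => simp [avoids213_nil]
  | cons y q ih =>
    have hy : ∀ z ∈ p, z < y := h y List.mem_cons_self
    have hp : p.Pairwise (fun u v => ¬ (u < y ∧ y < v)) :=
      List.Pairwise.imp_of_mem (R := fun _ _ => True)
        (fun _ hv _ huv => absurd huv.2 (hy _ hv).not_gt) (List.pairwise_of_forall fun _ _ => trivial)
    have hqp : ∀ u ∈ q, ∀ v ∈ p, ¬ (u < y ∧ y < v) :=
      fun u _ v hv huv => absurd huv.2 (hy v hv).not_gt
    rw [List.cons_append, avoids213_cons, avoids213_cons, List.pairwise_append,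
      ih fun u hu => h u (List.mem_cons_of_mem _ hu)]
    tauto

theorem eq_filter_append_filter {x : ℕ} {l : List ℕ}
    (h : l.Pairwise fun y z => ¬ (y < x ∧ x < z)) (hx : x ∉ l) :
    l = l.filter (x < ·) ++ l.filter (· < x) := by
  induction l with
  | nil => rfl
  | cons y l ih =>
    rw [List.pairwise_cons] at h
    rw [List.mem_cons, not_or] at hx
    have ih := ih h.2 hx.2
    rcases lt_or_gt_of_ne hx.1 with hxy | hxy
    · rw [List.filter_cons_of_pos (by simpa using hxy),
        List.filter_cons_of_neg (by simpa using hxy.le), List.cons_append, ← ih]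
    · have hnil : l.filter (x < ·) = [] := by
        rw [List.filter_eq_nil_iff]
        intro z hz
        have := h.1 z hz
        simp only [decide_eq_true_eq]
        tauto
      rw [hnil, List.nil_append] at ih
      rw [List.filter_cons_of_neg (by simpa using hxy.le), hnil,
        List.filter_cons_of_pos (by simpa using hxy), List.nil_append, ← ih]

/-- The `213`-avoiding arrangements of `a, a + 1, …, a + n - 1`. -/
def avoiders (a : ℕ) : ℕ → Finset (List ℕ)
  | 0 => {[]}
  | n + 1 => Finset.univ.biUnion fun i : Fin (n + 1) =>
      (avoiders a i ×ˢ avoiders (a + i + 1) (n - i)).image fun p => (a + i) :: (p.2 ++ p.1)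
termination_by n => n

theorem range'_split {a n i : ℕ} (hi : i ≤ n) :
    List.range' a (n + 1) = List.range' a i ++ (a + i) :: List.range' (a + i + 1) (n - i) := by
  rw [← List.range'_succ, List.range'_append_1]
  congr 1
  omega

theorem mem_avoiders {a n : ℕ} {l : List ℕ} :
    l ∈ avoiders a n ↔ l.Perm (List.range' a n) ∧ Avoids213 l := by
  induction n using Nat.strong_induction_on generalizing a l with
  | _ n ih =>
    cases n with
    | zero =>
      rw [avoiders, Finset.mem_singleton, List.range'_zero, List.perm_nil]
      exact ⟨fun h => ⟨h, h ▸ avoids213_nil⟩, And.left⟩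
    | succ n =>
      rw [avoiders]
      simp only [Finset.mem_biUnion, Finset.mem_univ, true_and, Finset.mem_image,
        Finset.mem_product, Prod.exists]
      constructor
      · rintro ⟨i, p, q, ⟨hp, hq⟩, rfl⟩
        obtain ⟨hp, hpa⟩ := (ih i i.2).1 hp
        obtain ⟨hq, hqa⟩ := (ih (n - i) (by omega)).1 hq
        refine ⟨?_, ?_⟩
        · rw [range'_split (Nat.lt_succ_iff.1 i.2)]
          exact (List.perm_append_comm.cons _).trans
            (List.perm_middle.symm.trans (hp.append (hq.cons _)))
        · have hp' : ∀ z ∈ p, z < a + i := fun z hz => by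
            have := List.mem_range'_1.1 (hp.mem_iff.1 hz)
            omega
          have hq' : ∀ z ∈ q, a + i < z := fun z hz => by
            have := List.mem_range'_1.1 (hq.mem_iff.1 hz)
            omega
          rw [avoids213_cons, avoids213_append fun y hy z hz => (hp' z hz).trans (hq' y hy)]
          refine ⟨List.pairwise_append.2 ⟨?_, ?_, ?_⟩, hqa, hpa⟩
          · exact List.Pairwise.imp_of_mem (R := fun _ _ => True)
              (fun hu _ _ huv => absurd huv.1 (hq' _ hu).not_gt)
              (List.pairwise_of_forall fun _ _ => trivial)
          · exact List.Pairwise.imp_of_mem (R := fun _ _ => True)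
              (fun _ hv _ huv => absurd huv.2 (hp' _ hv).not_gt)
              (List.pairwise_of_forall fun _ _ => trivial)
          · exact fun u hu v _ huv => absurd huv.1 (hq' _ hu).not_gt
      · rintro ⟨hl, hav⟩
        cases l with
        | nil => simpa using hl.length_eq
        | cons x l =>
          have hx := List.mem_range'_1.1 (hl.mem_iff.1 List.mem_cons_self)
          obtain ⟨i, rfl⟩ : ∃ i, x = a + i := ⟨x - a, by omega⟩
          have hi : i ≤ n := by omega
          have hnd : (a + i) ∉ l := (List.nodup_cons.1 (hl.nodup_iff.2 List.nodup_range')).1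
          obtain ⟨hpw, hav⟩ := (avoids213_cons _ _).1 hav
          have hsplit := eq_filter_append_filter hpw hnd
          have hlow : (l.filter (· < a + i)).Perm (List.range' a i) := by
            have h1 : (List.range' a i).filter (· < a + i) = List.range' a i := by
              simp [List.filter_eq_self]
            have h2 : (List.range' (a + i + 1) (n - i)).filter (· < a + i) = [] := by
              simp only [List.filter_eq_nil_iff, List.mem_range'_1, decide_eq_true_eq]
              omega
            have := hl.filter (· < a + i)
            rwa [List.filter_cons_of_neg (by simp), range'_split hi, List.filter_append, h1,
              List.filter_cons_of_neg (by simp), h2, List.append_nil] at this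
          have hhigh : (l.filter (a + i < ·)).Perm (List.range' (a + i + 1) (n - i)) := by
            have h1 : (List.range' a i).filter (a + i < ·) = [] := by
              simp only [List.filter_eq_nil_iff, List.mem_range'_1, decide_eq_true_eq]
              omega
            have h2 : (List.range' (a + i + 1) (n - i)).filter (a + i < ·) =
                List.range' (a + i + 1) (n - i) := by
              simp only [List.filter_eq_self, List.mem_range'_1, decide_eq_true_eq]
              omega
            have := hl.filter (a + i < ·)
            rwa [List.filter_cons_of_neg (by simp), range'_split hi, List.filter_append, h1,
              List.filter_cons_of_neg (by simp), h2, List.nil_append] at this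
          rw [hsplit, avoids213_append] at hav
          · exact ⟨⟨i, by omega⟩, _, _, ⟨(ih i (by omega)).2 ⟨hlow, hav.2⟩,
              (ih (n - i) (by omega)).2 ⟨hhigh, hav.1⟩⟩, by rw [← hsplit]⟩
          · intro y hy z hz
            simp only [List.mem_filter, decide_eq_true_eq] at hy hz
            omega

theorem card_avoiders (a n : ℕ) : (avoiders a n).card = catalan n := by
  induction n using Nat.strong_induction_on generalizing a with
  | _ n ih =>
    cases n with
    | zero => simp [avoiders]
    | succ n =>
      rw [avoiders, Finset.card_biUnion, catalan_succ]
      · refine Finset.sum_congr rfl fun i _ => ?_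
        rw [Finset.card_image_of_injOn, Finset.card_product, ih i i.2, ih (n - i) (by omega)]
        rintro ⟨p, q⟩ hpq ⟨p', q'⟩ hpq' h
        simp only [Finset.coe_product, Set.mem_prod, Finset.mem_coe, mem_avoiders] at hpq hpq'
        have hlen : q.length = q'.length :=
          (hpq.2.1.trans hpq'.2.1.symm).length_eq
        obtain ⟨h1, h2⟩ := List.append_inj (List.cons.inj h).2 hlen
        exact Prod.ext h2 h1
      · intro i _ k _ hik
        rw [Function.onFun, Finset.disjoint_left]
        intro l hl hl'
        simp only [Finset.mem_image] at hl hl'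
        obtain ⟨_, _, rfl⟩ := hl
        obtain ⟨_, _, h⟩ := hl'
        have := (List.cons.inj h).1
        exact hik (Fin.ext (by omega))

theorem runLen_cons_succ (x : ℤ) (s : List ℤ) (i : ℕ) :
    runLen (x :: s) (i + 1) = runLen s i := by
  rw [runLen, ncard_eq_add_ncard_succ (finite_of_forall_lt_length (s := x :: s) fun _ h => h.2.1),
    if_neg (by simp), zero_add, runLen]
  congr 1
  ext j
  simp only [Set.mem_ofPred_eq, List.length_cons, Nat.add_le_add_iff_right,
    Nat.add_lt_add_iff_right]
  refine and_congr_right fun _ => and_congr_right fun _ => ⟨fun h k h1 h2 => ?_,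
    fun h k h1 h2 => ?_⟩
  · simpa using h (k + 1) (by omega) (by omega)
  · obtain ⟨k, rfl⟩ : ∃ l, k = l + 1 := ⟨k - 1, by omega⟩
    simpa using h k (by omega) (by omega)

theorem runLen_cons_zero_of_ne {x : ℤ} {s : List ℤ} (hx : x ≠ -1) : runLen (x :: s) 0 = 0 := by
  rw [runLen, Set.ncard_eq_zero (finite_of_forall_lt_length (s := x :: s) fun _ h => h.2.1)]
  refine Set.eq_empty_of_forall_notMem fun j hj => hx ?_
  simpa using hj.2.2 0 le_rfl (Nat.zero_le _)

theorem runLen_neg_one_cons (s : List ℤ) : runLen (-1 :: s) 0 = runLen s 0 + 1 := by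
  rw [runLen, ncard_eq_add_ncard_succ (finite_of_forall_lt_length (s := -1 :: s) fun _ h => h.2.1),
    if_pos (by simp), add_comm, runLen]
  congr 2
  ext j
  simp only [Set.mem_ofPred_eq, List.length_cons, Nat.add_lt_add_iff_right]
  refine and_congr (by simp) (and_congr_right fun _ => ⟨fun h k _ h2 => ?_, fun h k _ h2 => ?_⟩)
  · simpa using h (k + 1) (by omega) (by omega)
  · cases k with
    | zero => rfl
    | succ k => simpa using h k (by omega) (by omega)

theorem runLen_nil (i : ℕ) : runLen [] i = 0 := by simp [runLen]

theorem isRunStart_cons_zero (x : ℤ) (s : List ℤ) : IsRunStart (x :: s) 0 ↔ x = -1 := by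
  simp [IsRunStart]

theorem isRunStart_cons_succ_succ (x : ℤ) (s : List ℤ) (i : ℕ) :
    IsRunStart (x :: s) (i + 2) ↔ IsRunStart s (i + 1) := by
  simp [IsRunStart]
  intros
  omega

theorem isRunStart_cons_one (x : ℤ) (s : List ℤ) :
    IsRunStart (x :: s) 1 ↔ IsRunStart s 0 ∧ x ≠ -1 := by
  simp [IsRunStart, and_assoc]

theorem zeroSteps_nil : zeroSteps [] = 0 := by simp [zeroSteps]

theorem zeroSteps_cons (x : ℤ) (s : List ℤ) :
    zeroSteps (x :: s) = zeroSteps s + if x = 0 then 1 else 0 := by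
  rw [zeroSteps, ncard_eq_add_ncard_succ (finite_of_forall_lt_length (s := x :: s) fun _ h => h.1),
    add_comm, zeroSteps]
  simp

/-- The decorations allowed at index `i` of the walk `s`. -/
noncomputable def decorationsAt (s : List ℤ) (i : ℕ) : Finset (List ℕ) :=
  open Classical in if IsRunStart s i then avoiders 1 (runLen s i + 1) else {[]}

theorem isDecorated_iff (s : List ℤ) (dec : ℕ → List ℕ) :
    IsDecorated s dec ↔ IsMotzkin s ∧ ∀ i, dec i ∈ decorationsAt s i := by
  rw [IsDecorated, ← forall_and]
  refine and_congr_right fun _ => forall_congr' fun i => ?_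
  by_cases hi : IsRunStart s i <;> simp [decorationsAt, hi, mem_avoiders]

theorem card_decorationsAt_zero (s : List ℤ) :
    (decorationsAt s 0).card = catalan (runLen s 0 + 1) := by
  by_cases hi : IsRunStart s 0
  · simp [decorationsAt, hi, card_avoiders]
  · have : runLen s 0 = 0 := by
      cases s with
      | nil => exact runLen_nil 0
      | cons x s =>
        exact runLen_cons_zero_of_ne fun hx => hi ((isRunStart_cons_zero x s).2 hx)
    simp [decorationsAt, hi, this]

theorem decorationsAt_cons_succ {x : ℤ} {s : List ℤ} {i : ℕ} (h : x = -1 → i ≠ 0) :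
    decorationsAt (x :: s) (i + 1) = decorationsAt s i := by
  have : IsRunStart (x :: s) (i + 1) ↔ IsRunStart s i := by
    cases i with
    | zero => simpa [isRunStart_cons_one] using fun _ hx => (h hx) rfl
    | succ i => exact isRunStart_cons_succ_succ x s i
  by_cases hi : IsRunStart s i
  · simp [decorationsAt, hi, this.2 hi, runLen_cons_succ]
  · simp [decorationsAt, hi, mt this.1 hi]

theorem decorationsAt_neg_one_cons_one (s : List ℤ) : decorationsAt (-1 :: s) 1 = {[]} := by
  simp [decorationsAt, isRunStart_cons_one]

theorem decorationsAt_of_length_le {s : List ℤ} {i : ℕ} (h : s.length ≤ i) :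
    decorationsAt s i = {[]} := by
  rw [decorationsAt, if_neg fun hi => h.not_gt hi.1]

/-- The number of decorations of `s`, its initial descending sequence being left undecorated. -/
noncomputable def innerDecorations (s : List ℤ) : ℕ :=
  ∏ i ∈ Finset.range s.length, (decorationsAt s (i + 1)).card

/-- The number of decorations of `s`. -/
noncomputable def numDecorations (s : List ℤ) : ℕ :=
  innerDecorations s * catalan (runLen s 0 + 1)

theorem numDecorations_eq_prod (s : List ℤ) :
    numDecorations s = ∏ i ∈ Finset.range (s.length + 1), (decorationsAt s i).card := by
  rw [Finset.prod_range_succ', card_decorationsAt_zero]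
  rfl

theorem innerDecorations_cons_of_ne {x : ℤ} (s : List ℤ) (hx : x ≠ -1) :
    innerDecorations (x :: s) = numDecorations s := by
  rw [numDecorations_eq_prod, innerDecorations, List.length_cons]
  exact Finset.prod_congr rfl fun i _ => by
    rw [decorationsAt_cons_succ fun h => absurd h hx]

theorem innerDecorations_neg_one_cons (s : List ℤ) :
    innerDecorations (-1 :: s) = innerDecorations s := by
  rw [innerDecorations, List.length_cons, Finset.prod_range_succ', zero_add,
    decorationsAt_neg_one_cons_one, Finset.card_singleton, mul_one]
  exact Finset.prod_congr rfl fun i _ => by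
    rw [decorationsAt_cons_succ fun _ => i.succ_ne_zero]

theorem card_pi_of_eq_singleton {α : Type*} (S : ℕ → Finset α) (d : α) (n : ℕ)
    (hS : ∀ i, n ≤ i → S i = {d}) :
    Nat.card {f : ℕ → α // ∀ i, f i ∈ S i} = ∏ i ∈ Finset.range n, (S i).card := by
  have e : {f : ℕ → α // ∀ i, f i ∈ S i} ≃ ∀ i : Fin n, S i :=
    { toFun := fun f i => ⟨f.1 i, f.2 i⟩
      invFun := fun g => ⟨fun i => if h : i < n then g ⟨i, h⟩ else d, fun i => by
        by_cases h : i < n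
        · simp [h]
        · simp [h, hS i (not_lt.1 h)]⟩
      left_inv := fun f => by
        ext i
        by_cases h : i < n
        · simp [h]
        · have := f.2 i
          rw [hS i (not_lt.1 h), Finset.mem_singleton] at this
          simp [h, this]
      right_inv := fun g => by
        ext i
        simp }
  rw [Nat.card_congr e, Nat.card_pi, ← Fin.prod_univ_eq_prod_range fun i => (S i).card]
  simp

theorem card_decorations (s : List ℤ) :
    Nat.card {dec : ℕ → List ℕ // ∀ i, dec i ∈ decorationsAt s i} = numDecorations s := by
  rw [numDecorations_eq_prod]
  exact card_pi_of_eq_singleton _ [] _ fun i hi => decorationsAt_of_length_le (by omega)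

/-- The Motzkin walks from `0` to `1`, positive except at the origin, whose last step of value `0`
or `+1` is a `+1`-step. -/
def IsPositiveMotzkin (s : List ℤ) : Prop :=
  IsMotzkin s ∧ ht s s.length = 1 ∧ (∀ i, 1 ≤ i → i ≤ s.length → 0 < ht s i) ∧ LastUpIsPlus s

theorem isPositiveMotzkin_iff (s : List ℤ) :
    IsPositiveMotzkin s ↔ IsMotzkin s ∧ s.sum = 1 ∧ (∀ i, 1 ≤ i → (s.drop i).sum ≤ 0) ∧
      LastUpIsPlus s := by
  rw [IsPositiveMotzkin, ht_length]
  refine and_congr_right fun _ => and_congr_right fun h0 => and_congr_left fun _ =>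
    ⟨fun h i h1 => ?_, fun h i h1 _ => ?_⟩
  · rcases le_total i s.length with hi | hi
    · have := h i h1 hi
      have := ht_add_sum_drop s i
      omega
    · simp [List.drop_eq_nil_of_le hi]
  · have := h i h1
    have := ht_add_sum_drop s i
    omega

theorem lastUpIsPlus_cons {s : List ℤ} (h : LastUpIsPlus s) (x : ℤ) : LastUpIsPlus (x :: s) := by
  obtain ⟨i, h1, h2, h3⟩ := h
  refine ⟨i + 1, by simpa using h1, by simpa using h2, fun k hk hk' => ?_⟩
  obtain ⟨k, rfl⟩ : ∃ l, k = l + 1 := ⟨k - 1, by omega⟩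
  simpa using h3 k (by omega) (by simpa using hk')

theorem lastUpIsPlus_one_cons_replicate (r : ℕ) : LastUpIsPlus (1 :: List.replicate r (-1)) := by
  refine ⟨0, by simp, by simp, fun k hk hk' => ?_⟩
  obtain ⟨k, rfl⟩ : ∃ l, k = l + 1 := ⟨k - 1, by omega⟩
  have : k < r := by simpa using hk'
  simp [this]

theorem not_lastUpIsPlus_replicate (r : ℕ) : ¬ LastUpIsPlus (List.replicate r (-1)) := by
  rintro ⟨i, h1, h2, -⟩
  rw [List.length_replicate] at h1
  simp [h1] at h2

theorem not_lastUpIsPlus_append_zero_cons (l : List ℤ) (r : ℕ) :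
    ¬ LastUpIsPlus (l ++ 0 :: List.replicate r (-1)) := by
  rintro ⟨i, h1, h2, h3⟩
  rcases lt_trichotomy i l.length with h | rfl | h
  · have := h3 l.length h (by simp)
    simp at this
  · simp at h2
  · obtain ⟨k, rfl⟩ : ∃ k, i = l.length + (k + 1) := ⟨i - l.length - 1, by omega⟩
    have hk : k < r := by
      simp at h1
      omega
    rw [List.getD_append_right _ _ _ _ (by omega)] at h2
    simp [hk] at h2

/-- The total weight of the decorations of `s`, zero if `s` is not the walk of an M-walk. -/
noncomputable def decoratedWeight (s : List ℤ) : Polynomial ℤ :=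
  open Classical in
    if IsPositiveMotzkin s then numDecorations s * mark ^ zeroSteps s else 0

/-- `s` is the end, starting from height `h`, of a walk satisfying `IsPositiveMotzkin`, and
contains the last step of value `0` or `+1` of this walk. -/
structure IsMotzkinTail (s : List ℤ) (h : ℕ) : Prop where
  motzkin : IsMotzkin s
  drop_sum_nonpos : ∀ i, 1 ≤ i → (s.drop i).sum ≤ 0
  sum_eq : s.sum = 1 - h
  lastUp : LastUpIsPlus s

theorem isMotzkin_cons {x : ℤ} {s : List ℤ} :
    IsMotzkin (x :: s) ↔ (x = -1 ∨ x = 0 ∨ x = 1) ∧ IsMotzkin s := by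
  simp [IsMotzkin]

theorem IsMotzkinTail.cons {s : List ℤ} {h h' : ℕ} {x : ℤ} (hs : IsMotzkinTail s h) (h0 : h ≠ 0)
    (hx : x = -1 ∨ x = 0 ∨ x = 1) (hh : (h' : ℤ) = h - x) : IsMotzkinTail (x :: s) h' := by
  have hsum := hs.sum_eq
  refine ⟨isMotzkin_cons.2 ⟨hx, hs.motzkin⟩, fun i hi => ?_, ?_, lastUpIsPlus_cons hs.lastUp x⟩
  · obtain ⟨i, rfl⟩ : ∃ l, i = l + 1 := ⟨i - 1, by omega⟩
    rw [List.drop_succ_cons]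
    cases i with
    | zero => rw [List.drop_zero]; omega
    | succ i => exact hs.drop_sum_nonpos _ (by omega)
  · rw [List.sum_cons]
    omega

theorem IsMotzkinTail.runLen_eq_zero {s : List ℤ} (hs : IsMotzkinTail s 0) : runLen s 0 = 0 := by
  cases s with
  | nil => exact runLen_nil 0
  | cons x s =>
    refine runLen_cons_zero_of_ne fun hx => ?_
    have h1 := hs.drop_sum_nonpos 1 le_rfl
    have h2 := hs.sum_eq
    rw [List.drop_succ_cons, List.drop_zero] at h1
    rw [List.sum_cons] at h2
    push_cast at h2
    omega

theorem mul_motzkinWeight {s : List ℤ} {h : ℕ} (hs : IsMotzkinTail s h) (t : List ℤ) :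
    innerDecorations s * mark ^ zeroSteps s * motzkinWeight h (runLen s 0) t =
      decoratedWeight (t.reverse ++ s) := by
  induction t generalizing s h with
  | nil =>
    cases h with
    | zero =>
      have : IsPositiveMotzkin s := (isPositiveMotzkin_iff s).2
        ⟨hs.motzkin, by simpa using hs.sum_eq, hs.drop_sum_nonpos, hs.lastUp⟩
      simp [motzkinWeight, decoratedWeight, this, numDecorations, hs.runLen_eq_zero]
    | succ h =>
      have : ¬ IsPositiveMotzkin s := fun hA => by
        have h1 := ((isPositiveMotzkin_iff s).1 hA).2.1
        have h2 := hs.sum_eq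
        push_cast at h2
        omega
      simp [motzkinWeight, decoratedWeight, this]
  | cons x t ih =>
    by_cases h0 : h = 0
    · subst h0
      have : ¬ IsPositiveMotzkin ((x :: t).reverse ++ s) := fun hA => by
        have h1 := ((isPositiveMotzkin_iff _).1 hA).2.2.1 (x :: t).reverse.length (by simp)
        have h2 := hs.sum_eq
        rw [List.drop_left] at h1
        push_cast at h2
        omega
      rw [motzkinWeight, if_pos rfl, mul_zero, decoratedWeight, if_neg this]
    rw [List.reverse_cons, List.append_assoc, List.singleton_append, motzkinWeight, if_neg h0]
    by_cases h1 : x = -1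
    · subst h1
      rw [if_pos rfl, ← ih (hs.cons (h' := h + 1) h0 (by simp) (by simp)),
        innerDecorations_neg_one_cons, zeroSteps_cons, runLen_neg_one_cons]
      simp
    rw [if_neg h1]
    by_cases h2 : x = 0
    · subst h2
      rw [if_pos rfl, ← ih (hs.cons (h' := h) h0 (by simp) (by simp)),
        innerDecorations_cons_of_ne s h1, zeroSteps_cons, runLen_cons_zero_of_ne h1,
        numDecorations, if_pos rfl]
      push_cast
      ring
    rw [if_neg h2]
    by_cases h3 : x = 1
    · subst h3
      rw [if_pos rfl, ← ih (hs.cons (h' := h - 1) h0 (by simp) (by omega)),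
        innerDecorations_cons_of_ne s h1, zeroSteps_cons, runLen_cons_zero_of_ne h1,
        numDecorations, if_neg h2]
      push_cast
      ring
    have : ¬ IsPositiveMotzkin (t.reverse ++ x :: s) := fun hA => by
      have := hA.1 x (by simp)
      tauto
    rw [if_neg h3, mul_zero, decoratedWeight, if_neg this]

theorem runLen_replicate (r : ℕ) : runLen (List.replicate r (-1)) 0 = r := by
  induction r with
  | zero => exact runLen_nil 0
  | succ r ih => rw [List.replicate_succ, runLen_neg_one_cons, ih]

theorem innerDecorations_replicate (r : ℕ) : innerDecorations (List.replicate r (-1)) = 1 := by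
  induction r with
  | zero => rfl
  | succ r ih => rw [List.replicate_succ, innerDecorations_neg_one_cons, ih]

theorem zeroSteps_replicate (r : ℕ) : zeroSteps (List.replicate r (-1)) = 0 := by
  induction r with
  | zero => exact zeroSteps_nil
  | succ r ih =>
    rw [List.replicate_succ, zeroSteps_cons, ih]
    simp

theorem isMotzkinTail_one_cons_replicate (r : ℕ) :
    IsMotzkinTail (1 :: List.replicate r (-1)) r := by
  refine ⟨isMotzkin_cons.2 ⟨by simp, fun x hx => ?_⟩, fun i hi => ?_, ?_,
    lastUpIsPlus_one_cons_replicate r⟩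
  · exact Or.inl (List.eq_of_mem_replicate hx)
  · obtain ⟨i, rfl⟩ : ∃ l, i = l + 1 := ⟨i - 1, by omega⟩
    simp
  · simp
    ring

theorem startWeight_eq (r : ℕ) (t : List ℤ) :
    startWeight r t = decoratedWeight (t.reverse ++ List.replicate r (-1)) := by
  induction t generalizing r with
  | nil =>
    have : ¬ IsPositiveMotzkin (List.replicate r (-1)) := fun h =>
      not_lastUpIsPlus_replicate r h.2.2.2
    simp [startWeight, decoratedWeight, this]
  | cons x t ih =>
    rw [List.reverse_cons, List.append_assoc, List.singleton_append, startWeight]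
    by_cases h1 : x = -1
    · subst h1
      rw [if_pos rfl, ih, List.replicate_succ]
    rw [if_neg h1]
    by_cases h2 : x = 1
    · subst h2
      rw [if_pos rfl, ← mul_motzkinWeight (isMotzkinTail_one_cons_replicate r),
        innerDecorations_cons_of_ne _ h1, zeroSteps_cons, runLen_cons_zero_of_ne h1,
        numDecorations, innerDecorations_replicate, zeroSteps_replicate, runLen_replicate]
      simp
    have : ¬ IsPositiveMotzkin (t.reverse ++ x :: List.replicate r (-1)) := fun hA => by
      rcases hA.1 x (by simp) with h | rfl | h
      · exact h1 h
      · exact not_lastUpIsPlus_append_zero_cons _ _ hA.2.2.2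
      · exact h2 h
    rw [if_neg h2, decoratedWeight, if_neg this]

theorem startWeight_zero_eq (t : List ℤ) : startWeight 0 t = decoratedWeight t.reverse := by
  simpa using startWeight_eq 0 t

theorem card_decoratedMotzkin (n j : ℕ) :
    (Nat.card {p : List ℤ × (ℕ → List ℕ) //
        IsDecorated p.1 p.2 ∧ p.1.length = n ∧ ht p.1 n = 1 ∧
          (∀ i, 1 ≤ i → i ≤ n → 0 < ht p.1 i) ∧ LastUpIsPlus p.1 ∧ zeroSteps p.1 = j} : ℤ) =
      (∑ t ∈ stepLists {-1, 0, 1} n, startWeight 0 t).coeff j := by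
  classical
  simp only [startWeight_zero_eq]
  rw [sum_stepLists_reverse _ _ decoratedWeight, Polynomial.finsetSum_coeff]
  set V := (stepLists {-1, 0, 1} n).filter fun s => IsPositiveMotzkin s ∧ zeroSteps s = j with hV
  have hmem : ∀ p : List ℤ × (ℕ → List ℕ),
      (IsDecorated p.1 p.2 ∧ p.1.length = n ∧ ht p.1 n = 1 ∧
        (∀ i, 1 ≤ i → i ≤ n → 0 < ht p.1 i) ∧ LastUpIsPlus p.1 ∧ zeroSteps p.1 = j) ↔
      p.1 ∈ V ∧ ∀ i, p.2 i ∈ decorationsAt p.1 i := by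
    rintro ⟨s, dec⟩
    rw [isDecorated_iff, hV, Finset.mem_filter, mem_stepLists, IsPositiveMotzkin]
    constructor
    · rintro ⟨⟨h1, h2⟩, rfl, h3, h4, h5, h6⟩
      exact ⟨⟨⟨rfl, fun x hx => by simpa using h1 x hx⟩, ⟨h1, h3, h4, h5⟩, h6⟩, h2⟩
    · rintro ⟨⟨⟨rfl, -⟩, ⟨h1, h3, h4, h5⟩, h6⟩, h2⟩
      exact ⟨⟨h1, h2⟩, rfl, h3, h4, h5, h6⟩
  have e : {p : List ℤ × (ℕ → List ℕ) //
      IsDecorated p.1 p.2 ∧ p.1.length = n ∧ ht p.1 n = 1 ∧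
        (∀ i, 1 ≤ i → i ≤ n → 0 < ht p.1 i) ∧ LastUpIsPlus p.1 ∧ zeroSteps p.1 = j} ≃
      Σ s : V, {dec : ℕ → List ℕ // ∀ i, dec i ∈ decorationsAt s i} :=
    { toFun := fun p => ⟨⟨p.1.1, ((hmem _).1 p.2).1⟩, ⟨p.1.2, ((hmem _).1 p.2).2⟩⟩
      invFun := fun q => ⟨(q.1.1, q.2.1), (hmem _).2 ⟨q.1.2, q.2.2⟩⟩
      left_inv := fun _ => rfl
      right_inv := fun _ => rfl }
  have hfin : ∀ s : V, Finite {dec : ℕ → List ℕ // ∀ i, dec i ∈ decorationsAt s i} := fun s =>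
    Nat.finite_of_card_ne_zero <| by
      rw [card_decorations, numDecorations_eq_prod]
      refine Finset.prod_ne_zero_iff.2 fun i _ => ?_
      by_cases hi : IsRunStart s.1 i
      · have hc := succ_mul_catalan_eq_centralBinom (runLen s.1 i + 1)
        have := Nat.centralBinom_ne_zero (runLen s.1 i + 1)
        rw [← hc] at this
        simpa [decorationsAt, hi, card_avoiders] using this
      · simp [decorationsAt, hi]
  rw [Nat.card_congr e, Nat.card_sigma]
  simp only [card_decorations]
  rw [Finset.sum_coe_sort V numDecorations, hV, Finset.sum_filter, Nat.cast_sum]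
  refine Finset.sum_congr rfl fun s _ => ?_
  by_cases hA : IsPositiveMotzkin s
  · by_cases hj : zeroSteps s = j
    · simp [decoratedWeight, hA, hj, Polynomial.coeff_natCast_mul]
    · simp [decoratedWeight, hA, hj, Polynomial.coeff_natCast_mul, Polynomial.coeff_X_pow,
        Ne.symm hj]
  · simp [decoratedWeight, hA]

end BasketballWalk

/-- M-walks of length `n` with exactly `j` zero steps are equinumerous with basketball
excursions of length `n - 1` with exactly `j` staggered `±2`-steps. -/
theorem stmt19 (n j : ℕ) (hn : 1 ≤ n) :
    Nat.card {p : List ℤ × (ℕ → List ℕ) //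
        IsDecorated p.1 p.2 ∧ p.1.length = n ∧ ht p.1 n = 1 ∧
          (∀ i, 1 ≤ i → i ≤ n → 0 < ht p.1 i) ∧ LastUpIsPlus p.1 ∧ zeroSteps p.1 = j} =
    Nat.card {s : List ℤ // IsAWalk s ∧ s.length = n - 1 ∧ staggeredCount s = j} := by
  obtain ⟨m, rfl⟩ : ∃ m, n = m + 1 := ⟨n - 1, by omega⟩
  have h := BasketballWalk.card_decoratedMotzkin (m + 1) j
  rw [BasketballWalk.sum_startWeight_eq_sum_backWeight, ← BasketballWalk.card_excursions] at h
  exact_mod_cast h
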